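/- Theorem 2 (exact linear convergence of CC-DQM with event-triggered communication). Suppose the thresholds satisfy μ_k = α ρ^{k−1} with α > 0 and 0 < ρ < 1, and the penalty parameter c > 0 and compressor parameter δ satisfy the parameter condition: there exists β > ℓ²/(2 c λ₂ v) with G(β) > 0 and δ/(1−√δ)² < G(β)/(3 c λₙ + 2 c β λₙ + c λₙ²/(β λ₂)), where G(β) = c λ̂₁/2 − 2 c β λ₂ ℓ²/(2 c β λ₂ v − ℓ²) − (c² λ̂ₙ² + 4ℓ²)/(c β λ₂). Then the stacked sequence x_k converges to x* at a linear rate: there exist σ̃ ∈ (0,1) and C₀ ≥ 0 such that ‖x_k − x*‖² ≤ C₀ σ̃^k for all k ≥ 0. -/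

import Mathlib

open scoped RealInnerProductSpace BigOperators

noncomputable section

/-- Blockwise action of a matrix `A` on stacked vectors in `(ℝ^d)^n ≅ ℝ^{nd}`
(i.e. the action of `A ⊗ I_d`). -/
def blockMul {m n d : ℕ} (A : Matrix (Fin m) (Fin n) ℝ)
    (z : Fin n → EuclideanSpace ℝ (Fin d)) : Fin m → EuclideanSpace ℝ (Fin d) :=
  fun i => ∑ j, A i j • z j

/-- `t` is an eigenvalue of the real matrix `A`. -/
def IsEigenvalue {n : ℕ} (A : Matrix (Fin n) (Fin n) ℝ) (t : ℝ) : Prop :=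
  ∃ z : Fin n → ℝ, z ≠ 0 ∧ A.mulVec z = t • z

/-- The signed Laplacian `L = D - W` of a graph. -/
def signedLap {n : ℕ} (G : SimpleGraph (Fin n)) [DecidableRel G.Adj] :
    Matrix (Fin n) (Fin n) ℝ :=
  Matrix.diagonal (fun i => (G.degree i : ℝ)) - G.adjMatrix ℝ

/-- The unsigned Laplacian `L_s = D + W` of a graph. -/
def unsignedLap {n : ℕ} (G : SimpleGraph (Fin n)) [DecidableRel G.Adj] :
    Matrix (Fin n) (Fin n) ℝ :=
  Matrix.diagonal (fun i => (G.degree i : ℝ)) + G.adjMatrix ℝ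

/-- The CC-DQM iteration: initializations `y₀ = 0`, `φ₀ = 0`, the primal update
`x_{i,k+1} = x_{i,k} - (2 c dᵢ I + ∇²fᵢ(y_{i,k}))⁻¹ (∇fᵢ(x_{i,k}) + c Σ_{j ∈ Nᵢ} (y_{i,k} - y_{j,k}) + φ_{i,k})`,
the censored/compressed state update for `y`, and the dual update for `φ`. -/
def IsCCDQM {n d : ℕ} (G : SimpleGraph (Fin n)) [DecidableRel G.Adj]
    (f : Fin n → EuclideanSpace ℝ (Fin d) → ℝ) (c : ℝ) (μ : ℕ → ℝ)
    (C : EuclideanSpace ℝ (Fin d) → EuclideanSpace ℝ (Fin d))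
    (x y φ : ℕ → Fin n → EuclideanSpace ℝ (Fin d)) : Prop :=
  (∀ i, y 0 i = 0) ∧ (∀ i, φ 0 i = 0) ∧
  (∀ k i, x (k+1) i = x k i -
      Ring.inverse ((2 * c * (G.degree i : ℝ)) •
            (1 : EuclideanSpace ℝ (Fin d) →L[ℝ] EuclideanSpace ℝ (Fin d))
          + fderiv ℝ (gradient (f i)) (y k i))
        (gradient (f i) (x k i)
          + c • ∑ j ∈ G.neighborFinset i, (y k i - y k j) + φ k i)) ∧
  (∀ k i, y (k+1) i =
      if μ (k+1) ≤ ‖x (k+1) i - y k i‖ then y k i + C (x (k+1) i - y k i) else y k i) ∧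
  (∀ k i, φ (k+1) i = φ k i + c • ∑ j ∈ G.neighborFinset i, (y (k+1) i - y (k+1) j))

theorem Matrix.IsHermitian.quadratic_nonneg {n : ℕ} {A : Matrix (Fin n) (Fin n) ℝ}
    (hA : A.IsHermitian) {a₀ a₁ a₂ : ℝ}
    (h : ∀ t, IsEigenvalue A t → 0 ≤ a₀ + a₁ * t + a₂ * t ^ 2) (w : Fin n → ℝ) :
    0 ≤ a₀ * ∑ i, w i ^ 2 + a₁ * ∑ i, A.mulVec w i * w i + a₂ * ∑ i, A.mulVec w i ^ 2 := by
  set b := hA.eigenvectorBasis with hb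
  set W : EuclideanSpace ℝ (Fin n) := WithLp.toLp 2 w with hW
  set V : EuclideanSpace ℝ (Fin n) := WithLp.toLp 2 (A.mulVec w) with hV
  have hev : ∀ j, IsEigenvalue A (hA.eigenvalues j) := fun j => by
    refine ⟨⇑(b j), fun h0 => b.orthonormal.ne_zero j ?_, hA.mulVec_eigenvectorBasis j⟩
    ext i
    exact congrFun h0 i
  have hVj : ∀ j, ⟪b j, V⟫ = hA.eigenvalues j * ⟪b j, W⟫ := fun j => by
    have h1 := hA.mulVec_eigenvectorBasis j
    have h2 : ⟪b j, V⟫ = A.mulVec w ⬝ᵥ ⇑(b j) := by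
      simp [EuclideanSpace.inner_eq_star_dotProduct, hV]
    have h3 : ⟪b j, W⟫ = w ⬝ᵥ ⇑(b j) := by
      simp [EuclideanSpace.inner_eq_star_dotProduct, hW]
    rw [h2, h3, dotProduct_comm, Matrix.dotProduct_mulVec, ← Matrix.mulVec_transpose,
      show A.transpose = A from (Matrix.conjTranspose_eq_transpose_of_trivial A).symm.trans hA.eq, h1, smul_dotProduct,
      dotProduct_comm, smul_eq_mul]
  have e0 : ∑ i, w i ^ 2 = ∑ j, ⟪b j, W⟫ ^ 2 := by
    rw [b.sum_sq_inner_right, EuclideanSpace.real_norm_sq_eq]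
  have e2 : ∑ i, A.mulVec w i ^ 2 = ∑ j, ⟪b j, V⟫ ^ 2 := by
    rw [b.sum_sq_inner_right, EuclideanSpace.real_norm_sq_eq]
  have e1 : ∑ i, A.mulVec w i * w i = ∑ j, ⟪b j, W⟫ * ⟪b j, V⟫ := by
    have h1 := b.sum_inner_mul_inner W V
    simp only [real_inner_comm] at h1 ⊢
    rw [PiLp.inner_apply] at h1
    simpa [hW, hV, mul_comm] using h1.symm
  rw [e0, e1, e2, Finset.mul_sum, Finset.mul_sum, Finset.mul_sum, ← Finset.sum_add_distrib,
    ← Finset.sum_add_distrib]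
  refine Finset.sum_nonneg fun j _ => ?_
  rw [hVj j]
  nlinarith [mul_nonneg (h _ (hev j)) (sq_nonneg ⟪b j, W⟫)]

/-- The space of stacked vectors with its Euclidean norm. -/
abbrev Stacked (n d : ℕ) : Type := PiLp 2 (fun _ : Fin n => EuclideanSpace ℝ (Fin d))

theorem Stacked.inner_eq_sum {n d : ℕ} (z w : Stacked n d) : ⟪z, w⟫ = ∑ i, ⟪z i, w i⟫ := rfl

/-- `blockMul A` as a linear endomorphism of the space of stacked vectors. -/
def blockLin {n : ℕ} (d : ℕ) (A : Matrix (Fin n) (Fin n) ℝ) : Stacked n d →ₗ[ℝ] Stacked n d where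
  toFun z := WithLp.toLp 2 (blockMul A z.ofLp)
  map_add' z w := by
    ext i : 1
    simp [blockMul, Finset.sum_add_distrib]
  map_smul' r z := by
    ext i : 1
    simp [blockMul, Finset.smul_sum, smul_comm r]

theorem blockLin_apply {n d : ℕ} (A : Matrix (Fin n) (Fin n) ℝ) (z : Stacked n d) (i : Fin n) :
    blockLin d A z i = ∑ j, A i j • z j := rfl

theorem blockLin_apply_apply {n d : ℕ} (A : Matrix (Fin n) (Fin n) ℝ) (z : Stacked n d)
    (i : Fin n) (l : Fin d) : blockLin d A z i l = A.mulVec (fun j => z j l) i := by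
  simp [blockLin_apply, Matrix.mulVec, dotProduct]

theorem blockLin_isSymmetric {n d : ℕ} {A : Matrix (Fin n) (Fin n) ℝ} (hA : A.IsHermitian) :
    (blockLin d A).IsSymmetric := fun z w => by
  simp only [Stacked.inner_eq_sum, blockLin_apply, sum_inner, inner_sum, real_inner_smul_left,
    real_inner_smul_right]
  rw [Finset.sum_comm]
  refine Finset.sum_congr rfl fun i _ => Finset.sum_congr rfl fun j _ => ?_
  rw [← hA.apply i j]
  simp

theorem blockLin_quadratic_nonneg {n d : ℕ} {A : Matrix (Fin n) (Fin n) ℝ}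
    (hA : A.IsHermitian) {a₀ a₁ a₂ : ℝ}
    (h : ∀ t, IsEigenvalue A t → 0 ≤ a₀ + a₁ * t + a₂ * t ^ 2) (z : Stacked n d) :
    0 ≤ a₀ * ‖z‖ ^ 2 + a₁ * ⟪z, blockLin d A z⟫ + a₂ * ‖blockLin d A z‖ ^ 2 := by
  have hnorm : ∀ w : Stacked n d, ‖w‖ ^ 2 = ∑ l, ∑ i, w i l ^ 2 := fun w => by
    rw [PiLp.norm_sq_eq_of_L2, Finset.sum_comm]
    simp only [EuclideanSpace.real_norm_sq_eq]
  have hinner : ⟪z, blockLin d A z⟫ = ∑ l, ∑ i, blockLin d A z i l * z i l := by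
    rw [Finset.sum_comm]
    simp [PiLp.inner_apply]
  rw [hnorm, hnorm, hinner, Finset.mul_sum, Finset.mul_sum, Finset.mul_sum,
    ← Finset.sum_add_distrib, ← Finset.sum_add_distrib]
  refine Finset.sum_nonneg fun l _ => ?_
  simp only [blockLin_apply_apply]
  exact hA.quadratic_nonneg h fun i => z i l

theorem signedLap_eq_lapMatrix {n : ℕ} (G : SimpleGraph (Fin n)) [DecidableRel G.Adj] :
    signedLap G = G.lapMatrix ℝ := rfl

theorem signedLap_isHermitian {n : ℕ} (G : SimpleGraph (Fin n)) [DecidableRel G.Adj] :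
    (signedLap G).IsHermitian := G.isHermitian_lapMatrix (R := ℝ)

theorem unsignedLap_isHermitian {n : ℕ} (G : SimpleGraph (Fin n)) [DecidableRel G.Adj] :
    (unsignedLap G).IsHermitian := 
  (G.isHermitian_degMatrix (R := ℝ)).add (G.isHermitian_adjMatrix (R := ℝ))

theorem blockLin_signedLap_apply {n d : ℕ} (G : SimpleGraph (Fin n)) [DecidableRel G.Adj]
    (z : Stacked n d) (i : Fin n) :
    blockLin d (signedLap G) z i = ∑ j ∈ G.neighborFinset i, (z i - z j) := by
  simp [blockLin_apply, signedLap, sub_smul, Finset.sum_sub_distrib, Matrix.diagonal_apply,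
    SimpleGraph.adjMatrix_apply, ite_smul, SimpleGraph.neighborFinset_eq_filter,
    Finset.sum_filter, ← Nat.cast_smul_eq_nsmul ℝ]
  simp [← SimpleGraph.card_neighborFinset_eq_degree, SimpleGraph.neighborFinset_eq_filter]

theorem blockLin_signedLap_add_unsignedLap_apply {n d : ℕ} (G : SimpleGraph (Fin n))
    [DecidableRel G.Adj] (z : Stacked n d) (i : Fin n) :
    blockLin d (signedLap G) z i + blockLin d (unsignedLap G) z i
      = (2 * (G.degree i : ℝ)) • z i := by
  simp only [blockLin_apply, signedLap, unsignedLap, ← Finset.sum_add_distrib, ← add_smul,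
    Matrix.sub_apply, Matrix.add_apply, sub_add_add_cancel, Matrix.diagonal_apply]
  simp [← two_mul, ite_smul]

theorem blockLin_signedLap_const {n d : ℕ} (G : SimpleGraph (Fin n)) [DecidableRel G.Adj]
    (a : EuclideanSpace ℝ (Fin d)) :
    blockLin d (signedLap G) (WithLp.toLp 2 fun _ => a) = 0 := by
  ext i : 1
  simp [blockLin_signedLap_apply]

theorem exists_blockLin_signedLap_eq {n d : ℕ} {G : SimpleGraph (Fin n)} [DecidableRel G.Adj]
    (hconn : G.Connected) (b : Stacked n d) (hb : ∑ i, b i = 0) :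
    ∃ q, blockLin d (signedLap G) q = b := by
  have hsymm := blockLin_isSymmetric (d := d) (signedLap_isHermitian G)
  suffices b ∈ LinearMap.range (blockLin d (signedLap G)) from this
  rw [← Submodule.orthogonal_orthogonal (LinearMap.range (blockLin d (signedLap G))),
    hsymm.orthogonal_range, Submodule.mem_orthogonal]
  intro z hz
  have hconst : ∀ i j, z i = z j := fun i j => by
    ext l
    have h1 : (G.lapMatrix ℝ).mulVec (fun i => z i l) = 0 := by
      ext i
      rw [← signedLap_eq_lapMatrix, ← blockLin_apply_apply, LinearMap.mem_ker.mp hz]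
      rfl
    exact (SimpleGraph.lapMatrix_mulVec_eq_zero_iff_forall_reachable (G := G)).mp h1 i j
      (hconn.preconnected i j)
  obtain ⟨i₀⟩ := hconn.nonempty
  rw [Stacked.inner_eq_sum, Finset.sum_congr rfl fun i _ => by rw [hconst i i₀], ← inner_sum, hb,
    inner_zero_right]

theorem mul_norm_sq_le_inner_fderiv {E : Type*} [NormedAddCommGroup E] [InnerProductSpace ℝ E]
    {F : E → E} {m : ℝ} {y : E} (hF : DifferentiableAt ℝ F y)
    (h : ∀ x x', m * ‖x' - x‖ ^ 2 ≤ ⟪F x' - F x, x' - x⟫) (w : E) :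
    m * ‖w‖ ^ 2 ≤ ⟪fderiv ℝ F y w, w⟫ := by
  have hmono : Monotone fun t : ℝ => ⟪F (y + t • w), w⟫ - t * (m * ‖w‖ ^ 2) := by
    intro s t hst
    rcases hst.eq_or_lt with rfl | hlt
    · exact le_rfl
    have h1 := h (y + s • w) (y + t • w)
    rw [show y + t • w - (y + s • w) = (t - s) • w by rw [sub_smul]; abel, norm_smul,
      real_inner_smul_right, inner_sub_left, mul_pow, Real.norm_eq_abs, sq_abs] at h1
    have h2 : (t - s) * ((t - s) * (m * ‖w‖ ^ 2)) ≤
        (t - s) * (⟪F (y + t • w), w⟫ - ⟪F (y + s • w), w⟫) := by linarith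
    have h3 := le_of_mul_le_mul_left h2 (sub_pos.mpr hlt)
    dsimp only
    linarith
  have hline : HasDerivAt (fun t : ℝ => y + t • w) w 0 := by
    simpa using ((hasDerivAt_id (0 : ℝ)).smul_const w).const_add y
  have hFd : HasFDerivAt F (fderiv ℝ F y) (y + (0 : ℝ) • w) := by
    simpa using hF.hasFDerivAt
  have hd : HasDerivAt (fun t : ℝ => ⟪F (y + t • w), w⟫ - t * (m * ‖w‖ ^ 2))
      (⟪fderiv ℝ F y w, w⟫ - m * ‖w‖ ^ 2) 0 := by
    have h1 := (hFd.comp_hasDerivAt (0 : ℝ) hline).inner ℝ (hasDerivAt_const (0 : ℝ) w)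
    have h2 := h1.sub ((hasDerivAt_id (0 : ℝ)).mul_const (m * ‖w‖ ^ 2))
    exact h2.congr_deriv (by simp)
  linarith [hd.nonneg_of_monotone hmono]

theorem isUnit_of_inner_self_pos {E : Type*} [NormedAddCommGroup E] [InnerProductSpace ℝ E]
    [FiniteDimensional ℝ E] {T : E →L[ℝ] E} (hT : ∀ w, w ≠ 0 → 0 < ⟪T w, w⟫) : IsUnit T := by
  have hinj : Function.Injective T := by
    refine (injective_iff_map_eq_zero T).mpr fun w hw => ?_
    by_contra hne
    have := hT w hne
    rw [hw, inner_zero_left] at this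
    exact lt_irrefl _ this
  have : CompleteSpace E := FiniteDimensional.complete ℝ E
  exact ContinuousLinearMap.isUnit_iff_bijective.mpr
    ⟨hinj, (LinearMap.injective_iff_surjective (f := (T : E →ₗ[ℝ] E))).mp hinj⟩

theorem norm_fderiv_apply_le_of_lipschitz {E : Type*} [NormedAddCommGroup E] [NormedSpace ℝ E]
    {F : E → E} {K : ℝ} (hK : 0 ≤ K) {y : E} (hF : DifferentiableAt ℝ F y)
    (h : ∀ x x', ‖F x' - F x‖ ≤ K * ‖x' - x‖) (w : E) : ‖fderiv ℝ F y w‖ ≤ K * ‖w‖ := by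
  have hL : LipschitzWith ⟨K, hK⟩ F :=
    LipschitzWith.of_dist_le_mul fun a b => by rw [dist_eq_norm, dist_eq_norm]; exact h b a
  exact (fderiv ℝ F y).le_of_opNorm_le (hF.hasFDerivAt.le_of_lipschitz hL) w

theorem differentiable_gradient {E : Type*} [NormedAddCommGroup E] [InnerProductSpace ℝ E]
    [CompleteSpace E] {f : E → ℝ} (hf : ContDiff ℝ 2 f) : Differentiable ℝ (gradient f) := by
  have h1 : Differentiable ℝ (fderiv ℝ f) :=
    (hf.fderiv_right (m := 1) (by norm_num)).differentiable (by norm_num)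
  exact ((InnerProductSpace.toDual ℝ E).symm.toContinuousLinearEquiv.differentiable).comp h1

theorem sum_gradient_eq_zero_of_forall_le {ι E : Type*} [Fintype ι] [NormedAddCommGroup E]
    [InnerProductSpace ℝ E] [CompleteSpace E] {f : ι → E → ℝ} (hf : ∀ i, Differentiable ℝ (f i))
    {a : E} (ha : ∀ z, ∑ i, f i a ≤ ∑ i, f i z) : ∑ i, gradient (f i) a = 0 := by
  have h1 : HasFDerivAt (fun z => ∑ i, f i z) (∑ i, fderiv ℝ (f i) a) a :=
    HasFDerivAt.fun_sum fun i _ => (hf i a).hasFDerivAt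
  have h2 : ∑ i, fderiv ℝ (f i) a = 0 :=
    IsLocalMin.hasFDerivAt_eq_zero (Filter.Eventually.of_forall ha) h1
  apply (InnerProductSpace.toDual ℝ E).injective
  rw [map_sum, map_zero, ← h2]
  exact Finset.sum_congr rfl fun i _ => toDual_gradient

theorem norm_add_four_sq_le {E : Type*} [SeminormedAddCommGroup E] (a b c d : E) :
    ‖a + b + c + d‖ ^ 2 ≤ 4 * ‖a‖ ^ 2 + 8 * ‖b‖ ^ 2 + 8 * ‖c‖ ^ 2 + 2 * ‖d‖ ^ 2 := by
  have h1 : ‖a + b + c + d‖ ≤ ‖a‖ + ‖b‖ + ‖c‖ + ‖d‖ := norm_add₄_le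
  have h2 : ‖a + b + c + d‖ ^ 2 ≤ (‖a‖ + ‖b‖ + ‖c‖ + ‖d‖) ^ 2 := by gcongr
  nlinarith [sq_nonneg (‖a‖ + ‖b‖ + ‖c‖ - ‖d‖), sq_nonneg (‖a‖ - ‖b‖ - ‖c‖),
    sq_nonneg (‖b‖ - ‖c‖)]

theorem norm_sub_sq_le_two_mul {E : Type*} [SeminormedAddCommGroup E] (a b : E) :
    ‖a - b‖ ^ 2 ≤ 2 * (‖a‖ ^ 2 + ‖b‖ ^ 2) := by
  have h2 : ‖a - b‖ ^ 2 ≤ (‖a‖ + ‖b‖) ^ 2 := by gcongr; exact norm_sub_le a b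
  nlinarith [sq_nonneg (‖a‖ - ‖b‖)]

/-- One-step decrease of the Lyapunov function
`V(u, q) = c / 2 * ⟪u, S u⟫ + 1 / (2 * c) * ⟪q, L q⟫` along a perturbed primal-dual step. -/
theorem lyapunov_descent {E : Type*} [NormedAddCommGroup E] [InnerProductSpace ℝ E]
    {L S : E →ₗ[ℝ] E} (hL : L.IsSymmetric) (hS : S.IsSymmetric)
    {lam2 lamn lh1 lhn c v ℓ β b τ : ℝ}
    (hlam2 : 0 < lam2) (hc : 0 < c) (hβ : 0 < β) (hb : 0 < b) (hτ : 0 < τ)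
    (hL0 : ∀ z, 0 ≤ ⟪z, L z⟫) (hLn : ∀ z, ⟪z, L z⟫ ≤ lamn * ‖z‖ ^ 2)
    (hLsq : ∀ z, ‖L z‖ ^ 2 ≤ lamn ^ 2 * ‖z‖ ^ 2) (hL2 : ∀ z, lam2 * ⟪z, L z⟫ ≤ ‖L z‖ ^ 2)
    (hS1 : ∀ z, lh1 * ‖z‖ ^ 2 ≤ ⟪z, S z⟫) (hSsq : ∀ z, ‖S z‖ ^ 2 ≤ lhn ^ 2 * ‖z‖ ^ 2)
    {u Δ e e' g ε q : E} (heq : g + c • S Δ + ε + c • L (e - e') + L q = 0)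
    (hgu : v * ‖u‖ ^ 2 ≤ ⟪g, u⟫) (hg : ‖g‖ ^ 2 ≤ ℓ ^ 2 * ‖u‖ ^ 2)
    (hε : ‖ε‖ ^ 2 ≤ 4 * ℓ ^ 2 * ‖Δ‖ ^ 2) :
    c / 2 * ⟪u, S u⟫ + 1 / (2 * c) * ⟪q, L q⟫
        + (1 / (8 * c * b) - 1 / (8 * c * β)) * ⟪q, L q⟫
        + (v - τ - ℓ ^ 2 / (2 * c * b * lam2)) * ‖u‖ ^ 2 ≤
      c / 2 * ⟪u - Δ, S (u - Δ)⟫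
        + 1 / (2 * c) * ⟪q - c • (u + e'), L (q - c • (u + e'))⟫
        - (c * lh1 / 2 - ℓ ^ 2 / τ - (c ^ 2 * lhn ^ 2 + 4 * ℓ ^ 2) / (c * b * lam2)) * ‖Δ‖ ^ 2
        + (c * lamn / 2 + c * lamn ^ 2 / (2 * b * lam2)) * ‖e‖ ^ 2
        + (2 * c * β * lamn + c * lamn ^ 2 / (2 * b * lam2)) * ‖e'‖ ^ 2 := by
  have hLq : ‖L q‖ ^ 2 ≤ 4 * ℓ ^ 2 * ‖u‖ ^ 2 + 8 * (c ^ 2 * lhn ^ 2 + 4 * ℓ ^ 2) * ‖Δ‖ ^ 2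
      + 4 * c ^ 2 * lamn ^ 2 * (‖e‖ ^ 2 + ‖e'‖ ^ 2) := by
    have h1 := norm_add_four_sq_le g (c • S Δ) ε (c • L (e - e'))
    rw [eq_neg_of_add_eq_zero_left heq, norm_neg, norm_smul, norm_smul, Real.norm_eq_abs, mul_pow,
      mul_pow, sq_abs] at h1
    have h2 := mul_le_mul_of_nonneg_left (hSsq Δ) (sq_nonneg c)
    have h3 := mul_le_mul_of_nonneg_left
      ((hLsq (e - e')).trans (mul_le_mul_of_nonneg_left (norm_sub_sq_le_two_mul e e')
        (sq_nonneg lamn))) (sq_nonneg c)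
    linarith
  have hP : 1 / (8 * c * b) * ⟪q, L q⟫ ≤ ℓ ^ 2 / (2 * c * b * lam2) * ‖u‖ ^ 2
      + (c ^ 2 * lhn ^ 2 + 4 * ℓ ^ 2) / (c * b * lam2) * ‖Δ‖ ^ 2
      + c * lamn ^ 2 / (2 * b * lam2) * (‖e‖ ^ 2 + ‖e'‖ ^ 2) := by
    have h1 : 1 / (8 * c * b * lam2) * (lam2 * ⟪q, L q⟫) ≤ 1 / (8 * c * b * lam2) *
        (4 * ℓ ^ 2 * ‖u‖ ^ 2 + 8 * (c ^ 2 * lhn ^ 2 + 4 * ℓ ^ 2) * ‖Δ‖ ^ 2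
          + 4 * c ^ 2 * lamn ^ 2 * (‖e‖ ^ 2 + ‖e'‖ ^ 2)) :=
      mul_le_mul_of_nonneg_left ((hL2 q).trans hLq) (by positivity)
    convert h1 using 1
    · field_simp
    · field_simp
      ring
  have hqe : ⟪L q, e'⟫ ≤ 1 / (8 * c * β) * ⟪q, L q⟫ + 2 * c * β * (lamn * ‖e'‖ ^ 2) := by
    have h1 := hL0 (q - (4 * c * β) • e')
    rw [map_sub, map_smul, inner_sub_left, inner_sub_right, inner_sub_right, real_inner_smul_left,
      real_inner_smul_left, real_inner_smul_right, real_inner_smul_right, ← hL q e',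
      real_inner_comm (L q) e'] at h1
    have h2 := mul_le_mul_of_nonneg_left (hLn e') (show (0:ℝ) ≤ 2 * c * β by positivity)
    have h3 : 0 ≤ 1 / (8 * c * β) * (⟪q, L q⟫ - 4 * c * β * ⟪L q, e'⟫
        - (4 * c * β * ⟪L q, e'⟫ - 4 * c * β * (4 * c * β * ⟪e', L e'⟫))) :=
      mul_nonneg (by positivity) (by linarith)
    have h4 : 1 / (8 * c * β) * (⟪q, L q⟫ - 4 * c * β * ⟪L q, e'⟫
        - (4 * c * β * ⟪L q, e'⟫ - 4 * c * β * (4 * c * β * ⟪e', L e'⟫))) =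
        1 / (8 * c * β) * ⟪q, L q⟫ - ⟪L q, e'⟫ + 2 * c * β * ⟪e', L e'⟫ := by
      field_simp
      ring
    linarith
  have hεu : -⟪ε, u⟫ ≤ τ * ‖u‖ ^ 2 + ℓ ^ 2 / τ * ‖Δ‖ ^ 2 := by
    have h1 := sq_nonneg ‖ε + (2 * τ) • u‖
    rw [norm_add_sq_real, norm_smul, mul_pow, Real.norm_eq_abs, sq_abs,
      real_inner_smul_right] at h1
    have h2 : 0 ≤ 1 / (4 * τ) * (4 * ℓ ^ 2 * ‖Δ‖ ^ 2 + 2 * (2 * τ * ⟪ε, u⟫)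
        + (2 * τ) ^ 2 * ‖u‖ ^ 2) := mul_nonneg (by positivity) (by linarith)
    have h3 : 1 / (4 * τ) * (4 * ℓ ^ 2 * ‖Δ‖ ^ 2 + 2 * (2 * τ * ⟪ε, u⟫)
        + (2 * τ) ^ 2 * ‖u‖ ^ 2) = ℓ ^ 2 / τ * ‖Δ‖ ^ 2 + ⟪ε, u⟫ + τ * ‖u‖ ^ 2 := by
      field_simp
      ring
    linarith
  have heu : -⟪L e, u⟫ - 1 / 2 * ⟪u, L u⟫ ≤ 1 / 2 * (lamn * ‖e‖ ^ 2) := by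
    have h1 := hL0 (u + e)
    rw [map_add, inner_add_left, inner_add_right, inner_add_right, ← hL e u,
      real_inner_comm (L e) u] at h1
    linarith [hLn e]
  have hinner : ⟪g, u⟫ + c * ⟪S Δ, u⟫ + ⟪ε, u⟫ + c * (⟪L e, u⟫ - ⟪L e', u⟫) + ⟪L q, u⟫ = 0 := by
    have h1 := congrArg (fun z => ⟪z, u⟫) heq
    simpa only [inner_add_left, real_inner_smul_left, map_sub, inner_sub_left, inner_zero_left]
      using h1
  have hVS : ⟪u - Δ, S (u - Δ)⟫ = ⟪u, S u⟫ - 2 * ⟪S Δ, u⟫ + ⟪Δ, S Δ⟫ := by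
    rw [map_sub, inner_sub_left, inner_sub_right, inner_sub_right, ← hS Δ u,
      real_inner_comm (S Δ) u]
    ring
  have hVL : 1 / (2 * c) * ⟪q - c • (u + e'), L (q - c • (u + e'))⟫ =
      1 / (2 * c) * ⟪q, L q⟫ - ⟪L q, u⟫ - ⟪L q, e'⟫
        + c / 2 * (⟪u, L u⟫ + 2 * ⟪L e', u⟫ + ⟪e', L e'⟫) := by
    simp only [map_sub, map_smul, map_add, inner_sub_left, inner_sub_right, real_inner_smul_left,
      real_inner_smul_right, inner_add_left, inner_add_right]
    rw [← hL q u, ← hL q e', ← hL e' u, real_inner_comm (L q) u, real_inner_comm (L q) e',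
      real_inner_comm (L e') u]
    field_simp
    ring
  have heu' := mul_le_mul_of_nonneg_left heu hc.le
  have hΔ := mul_le_mul_of_nonneg_left (hS1 Δ) (show 0 ≤ c / 2 by positivity)
  have he' := mul_nonneg (show 0 ≤ c / 2 by positivity) (hL0 e')
  rw [hVS, hVL]
  linarith

theorem exists_geometric_bound {U : ℕ → ℝ} {q r M : ℝ} (hU : ∀ k, 0 ≤ U k) (hq : q < 1)
    (hr0 : 0 < r) (hr : r < 1) (hM : 0 ≤ M) (h : ∀ k, U (k + 1) ≤ q * U k + M * r ^ k) :
    ∃ σ K : ℝ, 0 < σ ∧ σ < 1 ∧ 0 ≤ K ∧ ∀ k, U k ≤ K * σ ^ k := by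
  set s := max q r with hs
  have hs1 : s < 1 := max_lt hq hr
  have hs0 : 0 < s := hr0.trans_le (le_max_right _ _)
  set σ := (1 + s) / 2 with hσ
  have hσs : 0 < σ - s := by rw [hσ]; linarith
  refine ⟨σ, U 0 + M / (σ - s), by linarith, by rw [hσ]; linarith,
    add_nonneg (hU 0) (div_nonneg hM hσs.le), fun k => ?_⟩
  induction k with
  | zero => simpa using div_nonneg hM hσs.le
  | succ k ih =>
    have hσk : 0 < σ ^ k := pow_pos (by linarith) k
    have h1 : q * U k ≤ s * U k := mul_le_mul_of_nonneg_right (le_max_left _ _) (hU k)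
    have h2 : s * U k ≤ s * ((U 0 + M / (σ - s)) * σ ^ k) := mul_le_mul_of_nonneg_left ih hs0.le
    have h3 : M * r ^ k ≤ M * σ ^ k := by
      have : r ≤ σ := (le_max_right q r).trans (by linarith)
      gcongr
    have h4 : (U 0 + M / (σ - s)) * σ ^ (k + 1) - s * ((U 0 + M / (σ - s)) * σ ^ k) =
        (U 0 * (σ - s) + M) * σ ^ k := by
      rw [pow_succ]
      field_simp
    have h5 : 0 ≤ U 0 * (σ - s) * σ ^ k := mul_nonneg (mul_nonneg (hU 0) hσs.le) hσk.le
    linarith [h k]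

/-- A Lyapunov function `V` whose decrease is perturbed by errors `e` converges geometrically, when
the errors are driven by the increments `D` with contraction factor `θ` and geometric noise. -/
theorem exists_geometric_bound_of_descent {V D e : ℕ → ℝ} {ζ g A B θ M r : ℝ}
    (hV : ∀ k, 0 ≤ V k) (hD : ∀ k, 0 ≤ D k) (he : ∀ k, 0 ≤ e k) (hζ : 0 < ζ)
    (hA : 0 ≤ A) (hB : 0 ≤ B) (hθ0 : 0 ≤ θ) (hθ1 : θ < 1) (hM : 0 ≤ M) (hr0 : 0 < r) (hr : r < 1)
    (hg : (A + B) * (θ ^ 2 / (1 - θ) ^ 2) < g)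
    (hdesc : ∀ k, (1 + ζ) * V (k + 1) ≤ V k - g * D k + A * e k + B * e (k + 1))
    (herr : ∀ k, e (k + 1) ≤ θ ^ 2 / (1 - θ) * D k + θ * e k + M * r ^ k) :
    ∃ σ K : ℝ, 0 < σ ∧ σ < 1 ∧ 0 ≤ K ∧ ∀ k, V k ≤ K * σ ^ k := by
  have hθ : 0 < 1 - θ := by linarith
  set s := (g - (A + B) * (θ ^ 2 / (1 - θ) ^ 2)) * (1 - θ) with hs
  have hs0 : 0 < s := mul_pos (by linarith) hθ
  set W := (A + B * θ) / (1 - θ) + s with hW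
  have hW0 : 0 < W := add_pos_of_nonneg_of_pos (by positivity) hs0
  have hWe : A + (B + W) * θ = W - s * (1 - θ) := by
    rw [hW]
    field_simp
    ring
  have hWD : (B + W) * (θ ^ 2 / (1 - θ)) ≤ g := by
    have h1 : (B + W) * (θ ^ 2 / (1 - θ)) = (A + B) * (θ ^ 2 / (1 - θ) ^ 2)
        + θ ^ 2 * (g - (A + B) * (θ ^ 2 / (1 - θ) ^ 2)) := by
      rw [hW, hs]
      field_simp
      ring
    have h2 : θ ^ 2 * (g - (A + B) * (θ ^ 2 / (1 - θ) ^ 2)) ≤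
        1 * (g - (A + B) * (θ ^ 2 / (1 - θ) ^ 2)) :=
      mul_le_mul_of_nonneg_right (pow_le_one₀ hθ0 hθ1.le) (by linarith)
    linarith
  set p := max (1 / (1 + ζ)) (1 - s * (1 - θ) / W) with hp
  have hp1 : p < 1 := max_lt (by rw [div_lt_one (by linarith)]; linarith)
    (by have : 0 < s * (1 - θ) / W := by positivity
        linarith)
  obtain ⟨σ, K, hσ0, hσ1, hK, hbound⟩ := exists_geometric_bound
    (U := fun k => (1 + ζ) * V k + W * e k) (q := p) (r := r) (M := (B + W) * M)
    (fun k => add_nonneg (mul_nonneg (by linarith) (hV k)) (mul_nonneg hW0.le (he k)))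
    hp1 hr0 hr (by positivity) fun k => by
      have h1 := mul_le_mul_of_nonneg_left (herr k) (show 0 ≤ B + W by positivity)
      have h2 := mul_le_mul_of_nonneg_right hWD (hD k)
      have h3 : V k ≤ p * ((1 + ζ) * V k) := by
        have : V k = 1 / (1 + ζ) * ((1 + ζ) * V k) := by field_simp
        exact this.le.trans (mul_le_mul_of_nonneg_right (le_max_left _ _)
          (mul_nonneg (by linarith) (hV k)))
      have h4 : (W - s * (1 - θ)) * e k ≤ p * (W * e k) := by
        have : (1 - s * (1 - θ) / W) * (W * e k) = (W - s * (1 - θ)) * e k := by field_simp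
        rw [← this]
        exact mul_le_mul_of_nonneg_right (le_max_right _ _) (mul_nonneg hW0.le (he k))
      rw [← hWe] at h4
      linarith [hdesc k]
  refine ⟨σ, K, hσ0, hσ1, hK, fun k => ?_⟩
  have h1 := hbound k
  have h2 := mul_nonneg hζ.le (hV k)
  have h3 := mul_nonneg hW0.le (he k)
  linarith

/-- The error left by a censored contractive compressor. -/
theorem censored_compression_error_sq_le {E : Type*} [NormedAddCommGroup E] {C : E → E} {θ m : ℝ}
    (hθ0 : 0 ≤ θ) (hθ1 : θ < 1) (hC : ∀ z, ‖C z - z‖ ^ 2 ≤ θ ^ 2 * ‖z‖ ^ 2) {x x' y y' : E}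
    (hy' : y' = if m ≤ ‖x' - y‖ then y + C (x' - y) else y) :
    ‖y' - x'‖ ^ 2 ≤ θ ^ 2 / (1 - θ) * ‖x' - x‖ ^ 2 + θ * ‖y - x‖ ^ 2 + m ^ 2 := by
  have hθ : 0 < 1 - θ := by linarith
  split_ifs at hy' with h
  · have h1 := hC (x' - y)
    rw [show C (x' - y) - (x' - y) = y' - x' by rw [hy']; abel] at h1
    have h2 : ‖x' - y‖ ^ 2 ≤ (‖x' - x‖ + ‖y - x‖) ^ 2 := by
      gcongr
      rw [show x' - y = (x' - x) - (y - x) by abel]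
      exact norm_sub_le _ _
    set a := ‖x' - x‖
    set b := ‖y - x‖
    have h3 : θ ^ 2 / (1 - θ) * a ^ 2 + θ * b ^ 2 - θ ^ 2 * (a + b) ^ 2 =
        θ / (1 - θ) * (θ * a - (1 - θ) * b) ^ 2 := by
      field_simp
      ring
    have h4 : 0 ≤ θ / (1 - θ) * (θ * a - (1 - θ) * b) ^ 2 := by positivity
    have h5 := mul_le_mul_of_nonneg_left h2 (sq_nonneg θ)
    linarith [sq_nonneg m]
  · have h1 : ‖y' - x'‖ ^ 2 ≤ m ^ 2 := by
      rw [hy', norm_sub_rev]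
      have := (not_le.mp h).le
      gcongr
    have h2 : 0 ≤ θ ^ 2 / (1 - θ) * ‖x' - x‖ ^ 2 + θ * ‖y - x‖ ^ 2 := by positivity
    linarith

theorem IsEigenvalue.nonneg_of_posSemidef {n : ℕ} {A : Matrix (Fin n) (Fin n) ℝ}
    (hA : A.PosSemidef) {t : ℝ} (ht : IsEigenvalue A t) : 0 ≤ t := by
  obtain ⟨z, hz, h⟩ := ht
  have h1 := hA.dotProduct_mulVec_nonneg z
  rw [h, star_trivial, dotProduct_smul, smul_eq_mul] at h1
  have h2 : 0 < z ⬝ᵥ z := by simpa using Matrix.dotProduct_star_self_pos_iff.mpr hz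
  exact nonneg_of_mul_nonneg_left h1 h2

theorem IsEigenvalue.pos_of_posDef {n : ℕ} {A : Matrix (Fin n) (Fin n) ℝ}
    (hA : A.PosDef) {t : ℝ} (ht : IsEigenvalue A t) : 0 < t := by
  obtain ⟨z, hz, h⟩ := ht
  have h1 := hA.dotProduct_mulVec_pos hz
  rw [h, star_trivial, dotProduct_smul, smul_eq_mul] at h1
  have h2 : 0 < z ⬝ᵥ z := by simpa using Matrix.dotProduct_star_self_pos_iff.mpr hz
  exact pos_of_mul_pos_left h1 h2.le

/-- The strict parameter condition survives a small decrease of `β`. -/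
theorem exists_relaxed_parameters {lam2 lamn lh1 lhn c v ℓ β Θ : ℝ}
    (hlam2 : 0 < lam2) (hlamn : 0 < lamn) (hc : 0 < c) (hv : 0 < v) (hΘ : 0 ≤ Θ)
    (hβ : ℓ ^ 2 / (2 * c * lam2 * v) < β)
    (hlt : Θ < (c * lh1 / 2 - 2 * c * β * lam2 * ℓ ^ 2 / (2 * c * β * lam2 * v - ℓ ^ 2)
          - (c ^ 2 * lhn ^ 2 + 4 * ℓ ^ 2) / (c * β * lam2)) /
        (3 * c * lamn + 2 * c * β * lamn + c * lamn ^ 2 / (β * lam2))) :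
    ∃ b τ : ℝ, 0 < b ∧ b < β ∧ 0 < τ ∧ 0 < v - τ - ℓ ^ 2 / (2 * c * b * lam2) ∧
      (c * lamn / 2 + c * lamn ^ 2 / (2 * b * lam2)
          + (2 * c * β * lamn + c * lamn ^ 2 / (2 * b * lam2))) * Θ <
        c * lh1 / 2 - ℓ ^ 2 / τ - (c ^ 2 * lhn ^ 2 + 4 * ℓ ^ 2) / (c * b * lam2) := by
  have hβ0 : 0 < β := lt_of_le_of_lt (by positivity) hβ
  have hden : 0 < 2 * c * β * lam2 * v - ℓ ^ 2 := by
    rw [div_lt_iff₀ (by positivity)] at hβ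
    linarith
  set τ : ℝ → ℝ := fun b => v - ℓ ^ 2 / (2 * c * b * lam2) - (β - b) with hτ
  have hτβ : τ β = (2 * c * β * lam2 * v - ℓ ^ 2) / (2 * c * β * lam2) := by
    simp only [hτ]
    field_simp
    ring
  have hτβ0 : 0 < τ β := by
    rw [hτβ]
    positivity
  have hτc : ContinuousAt τ β := by
    have : 2 * c * β * lam2 ≠ 0 := by positivity
    fun_prop (disch := assumption)
  have hτne : τ β ≠ 0 := hτβ0.ne'
  have hlim : (c * lamn / 2 + c * lamn ^ 2 / (2 * β * lam2)
          + (2 * c * β * lamn + c * lamn ^ 2 / (2 * β * lam2))) * Θ <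
        c * lh1 / 2 - ℓ ^ 2 / τ β - (c ^ 2 * lhn ^ 2 + 4 * ℓ ^ 2) / (c * β * lam2) := by
    rw [lt_div_iff₀ (by positivity)] at hlt
    have h1 : ℓ ^ 2 / τ β = 2 * c * β * lam2 * ℓ ^ 2 / (2 * c * β * lam2 * v - ℓ ^ 2) := by
      rw [hτβ, div_div_eq_mul_div]
      ring
    have h2 : c * lamn / 2 + c * lamn ^ 2 / (2 * β * lam2)
          + (2 * c * β * lamn + c * lamn ^ 2 / (2 * β * lam2)) =
        (3 * c * lamn + 2 * c * β * lamn + c * lamn ^ 2 / (β * lam2)) - 5 / 2 * (c * lamn) := by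
      field_simp
      ring
    rw [h1, h2]
    have h3 : 0 ≤ 5 / 2 * (c * lamn) * Θ := by positivity
    linarith
  have hev : ∀ᶠ b in nhds β, 0 < b ∧ 0 < τ b ∧
      (c * lamn / 2 + c * lamn ^ 2 / (2 * b * lam2)
          + (2 * c * β * lamn + c * lamn ^ 2 / (2 * b * lam2))) * Θ <
        c * lh1 / 2 - ℓ ^ 2 / τ b - (c ^ 2 * lhn ^ 2 + 4 * ℓ ^ 2) / (c * b * lam2) := by
    have h1 : 2 * β * lam2 ≠ 0 := by positivity
    have h2 : c * β * lam2 ≠ 0 := by positivity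
    refine (lt_mem_nhds hβ0).and ((hτc.eventually (lt_mem_nhds hτβ0)).and ?_)
    refine ContinuousAt.eventually_lt ?_ ?_ hlim
    · fun_prop (disch := assumption)
    · fun_prop (disch := assumption)
  obtain ⟨b, ⟨hb0, hτb, hb⟩, hbβ : b < β⟩ :=
    ((hev.filter_mono nhdsWithin_le_nhds).and
      (self_mem_nhdsWithin (a := β) (s := Set.Iio β))).exists
  refine ⟨b, τ b, hb0, hbβ, hτb, ?_, hb⟩
  simp only [hτ]
  linarith [hbβ]

theorem IsCCDQM.primal_eq {n d : ℕ} {G : SimpleGraph (Fin n)} [DecidableRel G.Adj]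
    {f : Fin n → EuclideanSpace ℝ (Fin d) → ℝ} {c : ℝ} {μ : ℕ → ℝ}
    {C : EuclideanSpace ℝ (Fin d) → EuclideanSpace ℝ (Fin d)}
    {x y φ : ℕ → Fin n → EuclideanSpace ℝ (Fin d)} (halg : IsCCDQM G f c μ C x y φ)
    (hunit : ∀ k i, IsUnit ((2 * c * (G.degree i : ℝ)) •
      (1 : EuclideanSpace ℝ (Fin d) →L[ℝ] EuclideanSpace ℝ (Fin d))
        + fderiv ℝ (gradient (f i)) (y k i))) (k : ℕ) (Δ Y : Stacked n d)
    (hΔ : ∀ i, Δ i = x (k + 1) i - x k i) (hY : ∀ i, Y i = y k i) (i : Fin n) :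
    gradient (f i) (x k i) + fderiv ℝ (gradient (f i)) (y k i) (Δ i)
      + c • blockLin d (unsignedLap G) Δ i + c • blockLin d (signedLap G) Δ i
      + c • blockLin d (signedLap G) Y i + φ k i = 0 := by
  obtain ⟨-, -, hx, -, -⟩ := halg
  set T := (2 * c * (G.degree i : ℝ)) •
      (1 : EuclideanSpace ℝ (Fin d) →L[ℝ] EuclideanSpace ℝ (Fin d))
        + fderiv ℝ (gradient (f i)) (y k i) with hT
  set r := gradient (f i) (x k i)
          + c • ∑ j ∈ G.neighborFinset i, (y k i - y k j) + φ k i with hr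
  have h1 : T (Δ i) = -r := by
    have h2 : Δ i = -(Ring.inverse T r) := by
      rw [hΔ, hx k i]
      abel
    have h3 := congrArg (fun A => A r) (Ring.mul_inverse_cancel T (hunit k i))
    rw [h2, map_neg]
    exact congrArg Neg.neg h3
  have h2 := blockLin_signedLap_add_unsignedLap_apply G Δ i
  have h3 : T (Δ i) = c • ((2 * (G.degree i : ℝ)) • Δ i)
      + fderiv ℝ (gradient (f i)) (y k i) (Δ i) := by
    simp [hT, smul_smul]
    ring_nf
  rw [h3, ← h2, hr] at h1
  rw [blockLin_signedLap_apply G Y]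
  simp only [hY]
  rw [← sub_eq_zero, sub_neg_eq_add] at h1
  rw [← h1, smul_add]
  abel

/-- **Theorem 2** (exact linear convergence of CC-DQM with event-triggered communication).
If the thresholds decay geometrically, `μ_k = α ρ^{k-1}`, and the parameters `c, δ` satisfy
the parameter condition, then the stacked CC-DQM iterates converge to the consensus
optimum at a linear rate (in squared norm). -/
theorem ccdqm_linear_convergence_event_triggered
    {n d : ℕ} (G : SimpleGraph (Fin n)) [DecidableRel G.Adj] (hconn : G.Connected)
    (f : Fin n → EuclideanSpace ℝ (Fin d) → ℝ)
    (vi li : Fin n → ℝ) (v ℓ : ℝ)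
    (hf : ∀ i, ContDiff ℝ 2 (f i))
    (hvi : ∀ i, 0 < vi i)
    (hsc : ∀ i x x', vi i * ‖x' - x‖ ^ 2 ≤ ⟪gradient (f i) x' - gradient (f i) x, x' - x⟫)
    (hlip : ∀ i x x', ‖gradient (f i) x' - gradient (f i) x‖ ≤ li i * ‖x' - x‖)
    (hv : IsLeast (Set.range vi) v) (hℓ : IsGreatest (Set.range li) ℓ)
    (lam2 lamn lh1 lhn : ℝ)
    (hlam2 : IsEigenvalue (signedLap G) lam2 ∧ 0 < lam2 ∧
      ∀ t, IsEigenvalue (signedLap G) t → 0 < t → lam2 ≤ t)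
    (hlamn : IsEigenvalue (signedLap G) lamn ∧ ∀ t, IsEigenvalue (signedLap G) t → t ≤ lamn)
    (hlh1 : IsEigenvalue (unsignedLap G) lh1 ∧ ∀ t, IsEigenvalue (unsignedLap G) t → lh1 ≤ t)
    (hlhn : IsEigenvalue (unsignedLap G) lhn ∧ ∀ t, IsEigenvalue (unsignedLap G) t → t ≤ lhn)
    (hposdef : (unsignedLap G).PosDef)
    (c δ : ℝ) (hc : 0 < c) (hδ0 : 0 ≤ δ) (hδ1 : δ < 1)
    (C : EuclideanSpace ℝ (Fin d) → EuclideanSpace ℝ (Fin d))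
    (hC : ∀ z, ‖C z - z‖ ^ 2 ≤ δ * ‖z‖ ^ 2)
    (α ρ : ℝ) (hα : 0 < α) (hρ0 : 0 < ρ) (hρ1 : ρ < 1)
    (μ : ℕ → ℝ) (hμ : ∀ k : ℕ, μ (k + 1) = α * ρ ^ k)
    (x y φ : ℕ → Fin n → EuclideanSpace ℝ (Fin d))
    (halg : IsCCDQM G f c μ C x y φ)
    (xstar : EuclideanSpace ℝ (Fin d))
    (hxstar : ∀ z, ∑ i, f i xstar ≤ ∑ i, f i z)
    (hparam : ∃ β : ℝ, ℓ ^ 2 / (2 * c * lam2 * v) < β ∧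
      0 < c * lh1 / 2 - 2 * c * β * lam2 * ℓ ^ 2 / (2 * c * β * lam2 * v - ℓ ^ 2)
          - (c ^ 2 * lhn ^ 2 + 4 * ℓ ^ 2) / (c * β * lam2) ∧
      δ / (1 - Real.sqrt δ) ^ 2 <
        (c * lh1 / 2 - 2 * c * β * lam2 * ℓ ^ 2 / (2 * c * β * lam2 * v - ℓ ^ 2)
          - (c ^ 2 * lhn ^ 2 + 4 * ℓ ^ 2) / (c * β * lam2)) /
        (3 * c * lamn + 2 * c * β * lamn + c * lamn ^ 2 / (β * lam2))) :
    ∃ σt C₀ : ℝ, 0 < σt ∧ σt < 1 ∧ 0 ≤ C₀ ∧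
      ∀ k : ℕ, (∑ i, ‖x k i - xstar‖ ^ 2) ≤ C₀ * σt ^ k := by
  obtain ⟨β, hβ, -, hδlt⟩ := hparam
  obtain ⟨⟨i₀, hi₀⟩, hvle⟩ := hv
  have hv0 : 0 < v := hi₀ ▸ hvi i₀
  have hvle' : ∀ i, v ≤ vi i := fun i => hvle ⟨i, rfl⟩
  have hℓle : ∀ i, li i ≤ ℓ := fun i => hℓ.2 ⟨i, rfl⟩
  obtain ⟨hlam2e, hlam20, hlam2le⟩ := hlam2
  have hlamn0 : 0 < lamn := hlam20.trans_le (hlamn.2 _ hlam2e)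
  have hlh10 : 0 < lh1 := hlh1.1.pos_of_posDef hposdef
  have hlhn0 : 0 < lhn := hlh10.trans_le (hlhn.2 _ hlh1.1)
  have hβ0 : 0 < β := lt_of_le_of_lt (by positivity) hβ
  -- spectral bounds for the two Laplacians
  have hLH := signedLap_isHermitian G
  have hSH := unsignedLap_isHermitian G
  have hLsd : (signedLap G).PosSemidef := G.posSemidef_lapMatrix ℝ
  set L := blockLin d (signedLap G) with hLdef
  set S := blockLin d (unsignedLap G) with hSdef
  have hL0 : ∀ z, 0 ≤ ⟪z, L z⟫ := fun z => by
    have := blockLin_quadratic_nonneg hLH (a₀ := 0) (a₁ := 1) (a₂ := 0) (fun t ht => by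
      linarith [ht.nonneg_of_posSemidef hLsd]) z
    linarith
  have hLn : ∀ z, ⟪z, L z⟫ ≤ lamn * ‖z‖ ^ 2 := fun z => by
    have := blockLin_quadratic_nonneg hLH (a₀ := lamn) (a₁ := -1) (a₂ := 0) (fun t ht => by
      linarith [hlamn.2 t ht]) z
    linarith
  have hLsq : ∀ z, ‖L z‖ ^ 2 ≤ lamn ^ 2 * ‖z‖ ^ 2 := fun z => by
    have := blockLin_quadratic_nonneg hLH (a₀ := lamn ^ 2) (a₁ := 0) (a₂ := -1) (fun t ht => by
      have := pow_le_pow_left₀ (ht.nonneg_of_posSemidef hLsd) (hlamn.2 t ht) 2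
      linarith) z
    linarith
  have hL2 : ∀ z, lam2 * ⟪z, L z⟫ ≤ ‖L z‖ ^ 2 := fun z => by
    have := blockLin_quadratic_nonneg hLH (a₀ := 0) (a₁ := -lam2) (a₂ := 1) (fun t ht => by
      rcases (ht.nonneg_of_posSemidef hLsd).eq_or_lt with rfl | h0
      · simp
      · nlinarith [hlam2le t ht h0]) z
    linarith
  have hS1 : ∀ z, lh1 * ‖z‖ ^ 2 ≤ ⟪z, S z⟫ := fun z => by
    have := blockLin_quadratic_nonneg hSH (a₀ := -lh1) (a₁ := 1) (a₂ := 0) (fun t ht => by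
      linarith [hlh1.2 t ht]) z
    linarith
  have hSn : ∀ z, ⟪z, S z⟫ ≤ lhn * ‖z‖ ^ 2 := fun z => by
    have := blockLin_quadratic_nonneg hSH (a₀ := lhn) (a₁ := -1) (a₂ := 0) (fun t ht => by
      linarith [hlhn.2 t ht]) z
    linarith
  have hSsq : ∀ z, ‖S z‖ ^ 2 ≤ lhn ^ 2 * ‖z‖ ^ 2 := fun z => by
    have := blockLin_quadratic_nonneg hSH (a₀ := lhn ^ 2) (a₁ := 0) (a₂ := -1) (fun t ht => by
      have := pow_le_pow_left₀ (ht.pos_of_posDef hposdef).le (hlhn.2 t ht) 2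
      linarith) z
    linarith
  -- gradients and Hessians of the local objectives
  have hdiff : ∀ i, Differentiable ℝ (gradient (f i)) := fun i => differentiable_gradient (hf i)
  have hlipK : ∀ i a a', ‖gradient (f i) a' - gradient (f i) a‖ ≤ max ℓ 0 * ‖a' - a‖ :=
    fun i a a' => (hlip i a a').trans
      (mul_le_mul_of_nonneg_right ((hℓle i).trans (le_max_left _ _)) (norm_nonneg _))
  have hKsq : (max ℓ 0) ^ 2 ≤ ℓ ^ 2 := by
    rcases max_cases ℓ 0 with ⟨h, -⟩ | ⟨h, -⟩ <;> rw [h]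
    simpa using sq_nonneg ℓ
  have hunit : ∀ k i, IsUnit ((2 * c * (G.degree i : ℝ)) •
      (1 : EuclideanSpace ℝ (Fin d) →L[ℝ] EuclideanSpace ℝ (Fin d))
        + fderiv ℝ (gradient (f i)) (y k i)) := fun k i => by
    refine isUnit_of_inner_self_pos fun w hw => ?_
    have h1 := mul_norm_sq_le_inner_fderiv (hdiff i (y k i)) (hsc i) w
    have h2 : 0 < vi i * ‖w‖ ^ 2 := mul_pos (hvi i) (pow_pos (norm_pos_iff.mpr hw) 2)
    have h3 : 0 ≤ 2 * c * (G.degree i : ℝ) * ‖w‖ ^ 2 := by positivity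
    simp only [add_apply, smul_apply,
      one_apply_eq_self, inner_add_left, real_inner_smul_left,
      real_inner_self_eq_norm_sq]
    linarith
  -- stacked iterates
  have hprimal := halg.primal_eq hunit
  obtain ⟨-, hφ0, -, hy, hφ⟩ := halg
  set X : ℕ → Stacked n d := fun k => WithLp.toLp 2 (x k) with hX
  set Y : ℕ → Stacked n d := fun k => WithLp.toLp 2 (y k) with hY
  set Φ : ℕ → Stacked n d := fun k => WithLp.toLp 2 (φ k) with hΦ
  set Xs : Stacked n d := WithLp.toLp 2 fun _ => xstar with hXs
  set Gs : Stacked n d := WithLp.toLp 2 fun i => gradient (f i) xstar with hGs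
  set Gr : ℕ → Stacked n d := fun k => WithLp.toLp 2 fun i => gradient (f i) (x k i) with hGr
  have hLXs : L Xs = 0 := blockLin_signedLap_const G xstar
  obtain ⟨q₀, hq₀⟩ := exists_blockLin_signedLap_eq (d := d) hconn Gs
    (sum_gradient_eq_zero_of_forall_le (fun i => (hf i).differentiable (by norm_num)) hxstar)
  set Q : ℕ → Stacked n d := fun k => q₀ + c • ∑ j ∈ Finset.range k, (Y (j + 1) - Xs) with hQ
  have hQsucc : ∀ k, Q (k + 1) = Q k + c • (Y (k + 1) - Xs) := fun k => by
    simp only [hQ, Finset.sum_range_succ, smul_add, add_assoc]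
  have hΦsucc : ∀ k, Φ (k + 1) = Φ k + c • L (Y (k + 1)) := fun k => by
    ext i : 1
    simp only [PiLp.add_apply, PiLp.smul_apply, hLdef, blockLin_signedLap_apply]
    exact hφ k i
  have hLQ : ∀ k, L (Q k) = Φ k + Gs := fun k => by
    induction k with
    | zero =>
      have : Φ 0 = 0 := by
        ext i : 1
        exact hφ0 i
      simp [hQ, this, hLdef, hq₀]
    | succ k ih =>
      rw [hQsucc, map_add, ih, map_smul, map_sub, hLXs, sub_zero, hΦsucc]
      abel
  have hnorm : ∀ z : Stacked n d, ‖z‖ ^ 2 = ∑ i, ‖z i‖ ^ 2 := PiLp.norm_sq_eq_of_L2 _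
  -- Lyapunov function and its decrease
  obtain ⟨b, τ, hb0, hbβ, hτ0, hκ, hgap⟩ := exists_relaxed_parameters hlam20 hlamn0 hc hv0
    (by positivity) hβ hδlt
  set θ := Real.sqrt δ with hθ
  have hθ0 : 0 ≤ θ := Real.sqrt_nonneg δ
  have hθsq : θ ^ 2 = δ := Real.sq_sqrt hδ0
  have hθ1 : θ < 1 := by rw [hθ, Real.sqrt_lt' one_pos]; simpa using hδ1
  set κ := v - τ - ℓ ^ 2 / (2 * c * b * lam2) with hκdef
  set γ := 1 / (8 * c * b) - 1 / (8 * c * β) with hγdef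
  have hγ : 0 < γ := sub_pos.mpr (one_div_lt_one_div_of_lt (by positivity) (by gcongr))
  set V : ℕ → ℝ := fun k => c / 2 * ⟪X k - Xs, S (X k - Xs)⟫ + 1 / (2 * c) * ⟪Q k, L (Q k)⟫ with hV
  have hVlow : ∀ k, c / 2 * (lh1 * ‖X k - Xs‖ ^ 2) ≤ V k := fun k => by
    have h1 := mul_le_mul_of_nonneg_left (hS1 (X k - Xs)) (show 0 ≤ c / 2 by positivity)
    have h2 := mul_nonneg (show 0 ≤ 1 / (2 * c) by positivity) (hL0 (Q k))
    simp only [hV]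
    linarith
  set ζ := min (γ * (2 * c)) (κ * (2 / (c * lhn))) with hζdef
  have hζ : 0 < ζ := lt_min (by positivity) (by positivity)
  have hζV : ∀ k, ζ * V k ≤ γ * ⟪Q k, L (Q k)⟫ + κ * ‖X k - Xs‖ ^ 2 := fun k => by
    have h1 : ζ * (1 / (2 * c) * ⟪Q k, L (Q k)⟫) ≤
        γ * (2 * c) * (1 / (2 * c) * ⟪Q k, L (Q k)⟫) :=
      mul_le_mul_of_nonneg_right (min_le_left _ _) (mul_nonneg (by positivity) (hL0 _))
    have h2 : ζ * (c / 2 * ⟪X k - Xs, S (X k - Xs)⟫) ≤ ζ * (c / 2 * (lhn * ‖X k - Xs‖ ^ 2)) := by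
      have := hSn (X k - Xs)
      gcongr
    have h3 : ζ * (c / 2 * (lhn * ‖X k - Xs‖ ^ 2)) ≤
        κ * (2 / (c * lhn)) * (c / 2 * (lhn * ‖X k - Xs‖ ^ 2)) :=
      mul_le_mul_of_nonneg_right (min_le_right _ _) (by positivity)
    have h4 : γ * (2 * c) * (1 / (2 * c) * ⟪Q k, L (Q k)⟫) = γ * ⟪Q k, L (Q k)⟫ := by
      field_simp
    have h5 : κ * (2 / (c * lhn)) * (c / 2 * (lhn * ‖X k - Xs‖ ^ 2)) = κ * ‖X k - Xs‖ ^ 2 := by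
      field_simp
    simp only [hV]
    linarith
  obtain ⟨σ, K, hσ0, hσ1, hK, hbound⟩ := exists_geometric_bound_of_descent (V := V)
    (D := fun k => ‖X (k + 1) - X k‖ ^ 2) (e := fun k => ‖Y k - X k‖ ^ 2) (ζ := ζ)
    (g := c * lh1 / 2 - ℓ ^ 2 / τ - (c ^ 2 * lhn ^ 2 + 4 * ℓ ^ 2) / (c * b * lam2))
    (A := c * lamn / 2 + c * lamn ^ 2 / (2 * b * lam2))
    (B := 2 * c * β * lamn + c * lamn ^ 2 / (2 * b * lam2)) (θ := θ) (M := n * α ^ 2) (r := ρ ^ 2)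
    (fun k => le_trans (by positivity) (hVlow k)) (fun k => by positivity) (fun k => by positivity)
    hζ (by positivity) (by positivity) hθ0 hθ1 (by positivity) (by positivity)
    (pow_lt_one₀ hρ0.le hρ1 two_ne_zero) (by rw [hθsq]; exact hgap)
    (fun k => by
      set H : Stacked n d := WithLp.toLp 2 fun i =>
        fderiv ℝ (gradient (f i)) (y k i) (x (k + 1) i - x k i) with hH
      have heq : (Gr (k + 1) - Gs) + c • S (X (k + 1) - X k) + (Gr k - Gr (k + 1) + H)
          + c • L ((Y k - X k) - (Y (k + 1) - X (k + 1))) + L (Q (k + 1)) = 0 := by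
        have h1 : Gr k + H + c • S (X (k + 1) - X k) + c • L (X (k + 1) - X k) + c • L (Y k)
            + Φ k = 0 := by
          ext i : 1
          exact hprimal k (X (k + 1) - X k) (Y k) (fun _ => rfl) (fun _ => rfl) i
        rw [hLQ, hΦsucc, ← h1]
        simp only [map_sub, smul_sub]
        abel
      have hgu : v * ‖X (k + 1) - Xs‖ ^ 2 ≤ ⟪Gr (k + 1) - Gs, X (k + 1) - Xs⟫ := by
        rw [hnorm, Stacked.inner_eq_sum, Finset.mul_sum]
        exact Finset.sum_le_sum fun i _ =>
          (mul_le_mul_of_nonneg_right (hvle' i) (sq_nonneg _)).trans (hsc i _ _)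
      have hg : ‖Gr (k + 1) - Gs‖ ^ 2 ≤ ℓ ^ 2 * ‖X (k + 1) - Xs‖ ^ 2 := by
        rw [hnorm, hnorm, Finset.mul_sum]
        refine Finset.sum_le_sum fun i _ => ?_
        refine (pow_le_pow_left₀ (norm_nonneg _) (hlipK i xstar (x (k + 1) i)) 2).trans ?_
        rw [mul_pow]
        exact mul_le_mul_of_nonneg_right hKsq (sq_nonneg _)
      have hε : ‖Gr k - Gr (k + 1) + H‖ ^ 2 ≤ 4 * ℓ ^ 2 * ‖X (k + 1) - X k‖ ^ 2 := by
        rw [hnorm, hnorm, Finset.mul_sum]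
        refine Finset.sum_le_sum fun i _ => ?_
        have h1 := hlipK i (x (k + 1) i) (x k i)
        rw [norm_sub_rev (x k i)] at h1
        have h2 := norm_fderiv_apply_le_of_lipschitz (le_max_right ℓ 0) (hdiff i (y k i)) (hlipK i)
          (x (k + 1) i - x k i)
        have h3 : ‖(Gr k - Gr (k + 1) + H) i‖ ≤ 2 * max ℓ 0 * ‖x (k + 1) i - x k i‖ :=
          (norm_add_le _ _).trans ((add_le_add h1 h2).trans (by linarith))
        refine (pow_le_pow_left₀ (norm_nonneg _) h3 2).trans ?_
        rw [mul_pow, mul_pow]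
        exact mul_le_mul_of_nonneg_right (by linarith) (sq_nonneg _)
      have h1 := lyapunov_descent (blockLin_isSymmetric hLH) (blockLin_isSymmetric hSH)
        hlam20 hc hβ0 hb0 hτ0 hL0 hLn hLsq hL2 hS1 hSsq heq hgu hg hε
      rw [show X (k + 1) - Xs - (X (k + 1) - X k) = X k - Xs by abel,
        show X (k + 1) - Xs + (Y (k + 1) - X (k + 1)) = Y (k + 1) - Xs by abel,
        show Q (k + 1) - c • (Y (k + 1) - Xs) = Q k by rw [hQsucc]; abel] at h1
      have h2 := hζV (k + 1)
      simp only [hV] at h2 ⊢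
      linarith)
    (fun k => by
      rw [hnorm, hnorm, hnorm, Finset.mul_sum, Finset.mul_sum, ← Finset.sum_add_distrib]
      have h1 : (n : ℝ) * α ^ 2 * (ρ ^ 2) ^ k = ∑ _i : Fin n, (α * ρ ^ k) ^ 2 := by
        simp only [Finset.sum_const, Finset.card_univ, Fintype.card_fin, nsmul_eq_mul]
        ring
      rw [h1, ← Finset.sum_add_distrib]
      refine Finset.sum_le_sum fun i _ => ?_
      have h2 := hy k i
      rw [hμ k] at h2
      exact censored_compression_error_sq_le hθ0 hθ1 (by rwa [hθsq]) h2)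
  refine ⟨σ, 2 / (c * lh1) * K, hσ0, hσ1, by positivity, fun k => ?_⟩
  have h1 : ∑ i, ‖x k i - xstar‖ ^ 2 = ‖X k - Xs‖ ^ 2 := (hnorm (X k - Xs)).symm
  have h2 := mul_le_mul_of_nonneg_left ((hVlow k).trans (hbound k))
    (show 0 ≤ 2 / (c * lh1) by positivity)
  have h3 : 2 / (c * lh1) * (c / 2 * (lh1 * ‖X k - Xs‖ ^ 2)) = ‖X k - Xs‖ ^ 2 := by
    field_simp
  rw [h1, mul_assoc, ← h3]
  exact h2
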